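/- For every folding instruction set f: S_f(2) = 4 if (f_0, f_1, f_2) ∈ {(−1,−1,1), (−1,1,−1), (1,−1,1), (1,1,−1)}; S_f(2) = 5 if (f_0, f_1, f_2) ∈ {(−1,1,1), (1,−1,−1)}; and S_f(2) = 6 if (f_0, f_1, f_2) ∈ {(−1,−1,−1), (1,1,1)}. -/

import Mathlib

/-- A folding instruction set: a sequence with values in {-1, 1}. -/
def FoldingSeq (f : ℕ → ℤ) : Prop := ∀ s, f s = 1 ∨ f s = -1

/-- The paper-folding sequence `P_f`: if `k = 2^s * r` with `r` odd, then
`P_f[k] = f s` if `r ≡ 1 [MOD 4]` and `P_f[k] = -f s` if `r ≡ 3 [MOD 4]`. -/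
def PF (f : ℕ → ℤ) (k : ℕ) : ℤ :=
  if (k / 2 ^ (padicValNat 2 k)) % 4 = 1 then f (padicValNat 2 k)
  else -f (padicValNat 2 k)

/-- The length-`n` factors of `P_f` starting at indices `i` and `j` are identical. -/
def FactorMatch (f : ℕ → ℤ) (n i j : ℕ) : Prop :=
  ∀ t, t < n → PF f (i + t) = PF f (j + t)

/-- `Sf f n` : the least positive integer `m` such that every length-`n` factor of `P_f`
starts somewhere within the first `m` positions. -/
noncomputable def Sf (f : ℕ → ℤ) (n : ℕ) : ℕ :=
  sInf {m | 1 ≤ m ∧ ∀ i, 1 ≤ i → ∃ j, 1 ≤ j ∧ j ≤ m ∧ FactorMatch f n i j}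

/-- `Af f n` : the least positive integer `m` such that every length-`n` factor of `P_f`
appears entirely within the prefix `P_f[1..m]`. -/
noncomputable def Af (f : ℕ → ℤ) (n : ℕ) : ℕ :=
  sInf {m | 1 ≤ m ∧ ∀ i, 1 ≤ i → ∃ j, 1 ≤ j ∧ j + n - 1 ≤ m ∧ FactorMatch f n i j}

/-- `phi2 n` : the least power of 2 that is `≥ n`, i.e. `2 ^ ⌈log₂ n⌉`. -/
def phi2 (n : ℕ) : ℕ := 2 ^ Nat.clog 2 n

theorem PF_two_pow_mul (f : ℕ → ℤ) (s r : ℕ) (hr : r % 2 = 1) :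
    PF f (2 ^ s * r) = if r % 4 = 1 then f s else -f s := by
  have hv : padicValNat 2 (2 ^ s * r) = s := by
    rw [padicValNat.mul (by positivity) (by omega), padicValNat.prime_pow,
      padicValNat.eq_zero_of_not_dvd (by omega), add_zero]
  rw [PF, hv, Nat.mul_div_cancel_left _ (by positivity)]

theorem PF_eq_one_or_neg_one {f : ℕ → ℤ} (hf : FoldingSeq f) (k : ℕ) :
    PF f k = 1 ∨ PF f k = -1 := by
  unfold PF
  rcases hf (padicValNat 2 k) with h | h <;> rw [h] <;> split_ifs <;> simp

theorem factorMatch_two_iff (f : ℕ → ℤ) (i j : ℕ) :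
    FactorMatch f 2 i j ↔ PF f i = PF f j ∧ PF f (i + 1) = PF f (j + 1) := by
  refine ⟨fun h => ⟨h 0 (by norm_num), h 1 (by norm_num)⟩, fun h t ht => ?_⟩
  interval_cases t
  exacts [h.1, h.2]

/-- If every pair of signs occurs as a factor starting in the first `m` positions, and the factor
starting at `m` does not occur earlier, then `Sf f 2 = m`. -/
theorem Sf_two_eq {f : ℕ → ℤ} (hf : FoldingSeq f) {m : ℕ} (hm : 1 ≤ m)
    (hocc : ∀ a b : ℤ, (a = 1 ∨ a = -1) → (b = 1 ∨ b = -1) →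
      ∃ j, 1 ≤ j ∧ j ≤ m ∧ a = PF f j ∧ b = PF f (j + 1))
    (hnew : ∀ j, 1 ≤ j → j < m → ¬(PF f m = PF f j ∧ PF f (m + 1) = PF f (j + 1))) :
    Sf f 2 = m := by
  refine IsLeast.csInf_eq ⟨⟨hm, fun i _ => ?_⟩, fun n ⟨_, hn⟩ => ?_⟩
  · obtain ⟨j, h1, h2, h3⟩ :=
      hocc _ _ (PF_eq_one_or_neg_one hf i) (PF_eq_one_or_neg_one hf (i + 1))
    exact ⟨j, h1, h2, (factorMatch_two_iff f i j).2 h3⟩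
  · obtain ⟨j, h1, h2, h3⟩ := hn m hm
    by_contra hlt
    exact hnew j h1 (by omega) ((factorMatch_two_iff f m j).1 h3)

theorem stmt9 (f : ℕ → ℤ) (hf : FoldingSeq f) :
    (((f 0, f 1, f 2) = (-1, -1, 1) ∨ (f 0, f 1, f 2) = (-1, 1, -1) ∨
      (f 0, f 1, f 2) = (1, -1, 1) ∨ (f 0, f 1, f 2) = (1, 1, -1)) → Sf f 2 = 4) ∧
    (((f 0, f 1, f 2) = (-1, 1, 1) ∨ (f 0, f 1, f 2) = (1, -1, -1)) → Sf f 2 = 5) ∧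
    (((f 0, f 1, f 2) = (-1, -1, -1) ∨ (f 0, f 1, f 2) = (1, 1, 1)) → Sf f 2 = 6) := by
  have p1 : PF f 1 = f 0 := by simpa using PF_two_pow_mul f 0 1 rfl
  have p2 : PF f 2 = f 1 := by simpa using PF_two_pow_mul f 1 1 rfl
  have p3 : PF f 3 = -f 0 := by simpa using PF_two_pow_mul f 0 3 rfl
  have p4 : PF f 4 = f 2 := by simpa using PF_two_pow_mul f 2 1 rfl
  have p5 : PF f 5 = f 0 := by simpa using PF_two_pow_mul f 0 5 rfl
  have p6 : PF f 6 = -f 1 := by simpa using PF_two_pow_mul f 1 3 rfl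
  have p7 : PF f 7 = -f 0 := by simpa using PF_two_pow_mul f 0 7 rfl
  simp only [Prod.mk.injEq]
  refine ⟨?_, ?_, ?_⟩
  · intro h
    refine Sf_two_eq hf (by norm_num) (fun a b ha hb => ?_) (fun j h1 h2 => ?_)
    · have key : (a = PF f 1 ∧ b = PF f 2) ∨ (a = PF f 2 ∧ b = PF f 3) ∨
          (a = PF f 3 ∧ b = PF f 4) ∨ (a = PF f 4 ∧ b = PF f 5) := by
        rcases h with ⟨e0, e1, e2⟩ | ⟨e0, e1, e2⟩ | ⟨e0, e1, e2⟩ | ⟨e0, e1, e2⟩ <;>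
          rcases ha with rfl | rfl <;> rcases hb with rfl | rfl <;>
          norm_num [p1, p2, p3, p4, p5, e0, e1, e2]
      rcases key with h | h | h | h
      exacts [⟨1, by norm_num, by norm_num, h⟩, ⟨2, by norm_num, by norm_num, h⟩,
        ⟨3, by norm_num, by norm_num, h⟩, ⟨4, by norm_num, by norm_num, h⟩]
    · interval_cases j <;> norm_num only [p1, p2, p3, p4, p5] <;> omega
  · intro h
    refine Sf_two_eq hf (by norm_num) (fun a b ha hb => ?_) (fun j h1 h2 => ?_)
    · have key : (a = PF f 1 ∧ b = PF f 2) ∨ (a = PF f 2 ∧ b = PF f 3) ∨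
          (a = PF f 4 ∧ b = PF f 5) ∨ (a = PF f 5 ∧ b = PF f 6) := by
        rcases h with ⟨e0, e1, e2⟩ | ⟨e0, e1, e2⟩ <;>
          rcases ha with rfl | rfl <;> rcases hb with rfl | rfl <;>
          norm_num [p1, p2, p3, p4, p5, p6, e0, e1, e2]
      rcases key with h | h | h | h
      exacts [⟨1, by norm_num, by norm_num, h⟩, ⟨2, by norm_num, by norm_num, h⟩,
        ⟨4, by norm_num, by norm_num, h⟩, ⟨5, by norm_num, by norm_num, h⟩]
    · interval_cases j <;> norm_num only [p1, p2, p3, p4, p5, p6] <;> omega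
  · intro h
    refine Sf_two_eq hf (by norm_num) (fun a b ha hb => ?_) (fun j h1 h2 => ?_)
    · have key : (a = PF f 1 ∧ b = PF f 2) ∨ (a = PF f 2 ∧ b = PF f 3) ∨
          (a = PF f 3 ∧ b = PF f 4) ∨ (a = PF f 6 ∧ b = PF f 7) := by
        rcases h with ⟨e0, e1, e2⟩ | ⟨e0, e1, e2⟩ <;>
          rcases ha with rfl | rfl <;> rcases hb with rfl | rfl <;>
          norm_num [p1, p2, p3, p4, p6, p7, e0, e1, e2]
      rcases key with h | h | h | h
      exacts [⟨1, by norm_num, by norm_num, h⟩, ⟨2, by norm_num, by norm_num, h⟩,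
        ⟨3, by norm_num, by norm_num, h⟩, ⟨6, by norm_num, by norm_num, h⟩]
    · interval_cases j <;> norm_num only [p1, p2, p3, p4, p5, p6, p7] <;> omega
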